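/- arXiv:1407.5108 — 3 statements merged into one kernel-verified Lean document; each statement's English description precedes it below -/
import Mathlib

section
/- Let k be a field of positive characteristic p and X a Noetherian k-scheme, with reduction X_red. Then the kernel of the restriction map Pic(X) -> Pic(X_red) is killed by some power of p; that is, for every line bundle L on X whose restriction to X_red is trivial, there is an n such that L^{tensor p^n} is trivial. -/
open AlgebraicGeometry CategoryTheory Opposite TopologicalSpace

universe u

namespace LocalPic

/-- Restriction of invertible sections along an inclusion of opens. -/
def resU (X : Scheme.{u}) {U V : X.Opens} (h : V ≤ U) :
    (Γ(X, U))ˣ →* (Γ(X, V))ˣ :=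
  Units.map (X.presheaf.map (homOfLE h).op).hom.toMonoidHom

/-- Restriction of sections along an inclusion of opens. -/
def resS (X : Scheme.{u}) {U V : X.Opens} (h : V ≤ U) : ↥Γ(X, U) →+* ↥Γ(X, V) :=
  (X.presheaf.map (homOfLE h).op).hom

lemma resU_resU (X : Scheme.{u}) {U V W : X.Opens} (h1 : W ≤ V) (h2 : V ≤ U)
    (u : (Γ(X, U))ˣ) :
    resU X h1 (resU X h2 u) = resU X (h1.trans h2) u := by
  ext
  show (X.presheaf.map (homOfLE h1).op) ((X.presheaf.map (homOfLE h2).op) u) = _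
  rw [← CategoryTheory.comp_apply, ← Functor.map_comp, ← op_comp, homOfLE_comp]
  rfl

/-- A line bundle on the open subset `V` of a scheme `X`, presented by a Čech 1-cocycle
of invertible sections with respect to an open cover of `V`. -/
structure LineBundleOn (X : Scheme.{u}) (V : X.Opens) : Type (u + 1) where
  ι : Type u
  U : ι → X.Opens
  le : ∀ i, U i ≤ V
  covers : ∀ x ∈ V, ∃ i, x ∈ U i
  t : ∀ i j, (Γ(X, U i ⊓ U j))ˣ
  cocycle : ∀ i j k,
    resU X (inf_le_left : U i ⊓ U j ⊓ U k ≤ U i ⊓ U j) (t i j) *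
      resU X (le_inf (inf_le_left.trans inf_le_right) inf_le_right :
        U i ⊓ U j ⊓ U k ≤ U j ⊓ U k) (t j k) =
    resU X (le_inf (inf_le_left.trans inf_le_left) inf_le_right :
        U i ⊓ U j ⊓ U k ≤ U i ⊓ U k) (t i k)

namespace LineBundleOn

variable {X Y : Scheme.{u}} {V : X.Opens}

lemma cocycle_res (L : LineBundleOn X V) (i j k : L.ι) {W : X.Opens}
    (h : W ≤ L.U i ⊓ L.U j ⊓ L.U k)
    (h1 : W ≤ L.U i ⊓ L.U j) (h2 : W ≤ L.U j ⊓ L.U k) (h3 : W ≤ L.U i ⊓ L.U k) :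
    resU X h1 (L.t i j) * resU X h2 (L.t j k) = resU X h3 (L.t i k) := by
  have e := congrArg (resU X h) (L.cocycle i j k)
  rw [map_mul, resU_resU, resU_resU, resU_resU] at e
  exact e

/-- Tensor powers of a line bundle. -/
def pow (L : LineBundleOn X V) (n : ℕ) : LineBundleOn X V where
  ι := L.ι
  U := L.U
  le := L.le
  covers := L.covers
  t i j := (L.t i j) ^ n
  cocycle i j k := by rw [map_pow, map_pow, map_pow, ← mul_pow, L.cocycle]

/-- The inverse (dual) of a line bundle. -/
def inv (L : LineBundleOn X V) : LineBundleOn X V where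
  ι := L.ι
  U := L.U
  le := L.le
  covers := L.covers
  t i j := (L.t i j)⁻¹
  cocycle i j k := by rw [map_inv, map_inv, map_inv, ← mul_inv, L.cocycle]

/-- A line bundle is trivial if its cocycle is a coboundary, i.e. if it admits a
nowhere vanishing global section. -/
def IsTrivial (L : LineBundleOn X V) : Prop :=
  ∃ s : ∀ i, (Γ(X, L.U i))ˣ, ∀ i j,
    L.t i j = resU X inf_le_left (s i) * (resU X inf_le_right (s j))⁻¹

/-- A line bundle is torsion if some positive tensor power of it is trivial. -/
def IsTorsion (L : LineBundleOn X V) : Prop :=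
  ∃ n : ℕ, 0 < n ∧ IsTrivial (L.pow n)

def preimage_inf_le (f : Y ⟶ X) (A B : X.Opens) :
    f ⁻¹ᵁ A ⊓ f ⁻¹ᵁ B ≤ f ⁻¹ᵁ (A ⊓ B) := by
  intro x hx
  have hx' : x ∈ (↑(f ⁻¹ᵁ A ⊓ f ⁻¹ᵁ B) : Set Y) := hx
  rw [Opens.coe_inf] at hx'
  exact ⟨hx'.1, hx'.2⟩

/-- Mapping invertible sections along the pull-back of sections of a morphism. -/
def mapU (f : Y ⟶ X) {U : X.Opens} {W : Y.Opens} (e : W ≤ f ⁻¹ᵁ U) :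
    (Γ(X, U))ˣ →* (Γ(Y, W))ˣ :=
  Units.map (f.appLE U W e).hom.toMonoidHom

lemma resU_mapU (f : Y ⟶ X) {U : X.Opens} {W W' : Y.Opens} (e : W ≤ f ⁻¹ᵁ U)
    (h : W' ≤ W) (u : (Γ(X, U))ˣ) :
    resU Y h (mapU f e u) = mapU f (h.trans e) u := by
  ext
  show (Y.presheaf.map (homOfLE h).op) ((f.appLE U W e) u) = (f.appLE U W' _) u
  rw [← CategoryTheory.comp_apply, Scheme.Hom.appLE_map]

lemma mapU_resU (f : Y ⟶ X) {U U' : X.Opens} {W : Y.Opens} (hU : U' ≤ U)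
    (e : W ≤ f ⁻¹ᵁ U') (e' : W ≤ f ⁻¹ᵁ U) (u : (Γ(X, U))ˣ) :
    mapU f e (resU X hU u) = mapU f e' u := by
  ext
  show (f.appLE U' W e) ((X.presheaf.map (homOfLE hU).op) u) = (f.appLE U W e') u
  rw [← CategoryTheory.comp_apply, Scheme.Hom.map_appLE]

/-- Pullback of a line bundle along a morphism of schemes. -/
def pullback (f : Y ⟶ X) (L : LineBundleOn X V) : LineBundleOn Y (f ⁻¹ᵁ V) where
  ι := L.ι
  U i := f ⁻¹ᵁ L.U i
  le i x hx := L.le i hx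
  covers x hx := by
    obtain ⟨i, hi⟩ := L.covers (f.base x) hx
    exact ⟨i, hi⟩
  t i j := mapU f (preimage_inf_le f (L.U i) (L.U j)) (L.t i j)
  cocycle i j k := by
    rw [resU_mapU, resU_mapU, resU_mapU,
        ← mapU_resU f (inf_le_left : L.U i ⊓ L.U j ⊓ L.U k ≤ L.U i ⊓ L.U j),
        ← mapU_resU f (le_inf (inf_le_left.trans inf_le_right) inf_le_right :
          L.U i ⊓ L.U j ⊓ L.U k ≤ L.U j ⊓ L.U k),
        ← mapU_resU f (le_inf (inf_le_left.trans inf_le_left) inf_le_right :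
          L.U i ⊓ L.U j ⊓ L.U k ≤ L.U i ⊓ L.U k),
        ← map_mul, L.cocycle]
    intro x hx
    have hx' : x ∈ (↑(f ⁻¹ᵁ L.U i ⊓ f ⁻¹ᵁ L.U j ⊓ f ⁻¹ᵁ L.U k) : Set Y) := hx
    rw [Opens.coe_inf, Opens.coe_inf] at hx'
    exact ⟨⟨hx'.1.1, hx'.1.2⟩, hx'.2⟩
    exact fun x hx => ⟨⟨hx.1.1, hx.1.2⟩, hx.2⟩

/-- Tensor product of two line bundles on the same open set. -/
def mul (L M : LineBundleOn X V) : LineBundleOn X V where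
  ι := L.ι × M.ι
  U p := L.U p.1 ⊓ M.U p.2
  le p := inf_le_left.trans (L.le p.1)
  covers x hx := by
    obtain ⟨i, hi⟩ := L.covers x hx
    obtain ⟨a, ha⟩ := M.covers x hx
    exact ⟨(i, a), ⟨hi, ha⟩⟩
  t p q := resU X (le_inf (inf_le_left.trans inf_le_left) (inf_le_right.trans inf_le_left))
      (L.t p.1 q.1) *
    resU X (le_inf (inf_le_left.trans inf_le_right) (inf_le_right.trans inf_le_right))
      (M.t p.2 q.2)
  cocycle := by
    rintro ⟨i, a⟩ ⟨j, b⟩ ⟨k, c⟩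
    simp only [map_mul, resU_resU]
    rw [mul_mul_mul_comm,
      L.cocycle_res i j k (h := le_inf (le_inf
        ((inf_le_left.trans inf_le_left).trans inf_le_left)
        ((inf_le_left.trans inf_le_right).trans inf_le_left))
        (inf_le_right.trans inf_le_left)),
      M.cocycle_res a b c (h := le_inf (le_inf
        ((inf_le_left.trans inf_le_left).trans inf_le_right)
        ((inf_le_left.trans inf_le_right).trans inf_le_right))
        (inf_le_right.trans inf_le_right))]

/-- Restriction of a line bundle to a smaller open set. -/
def restrict (L : LineBundleOn X V) {V' : X.Opens} (h : V' ≤ V) : LineBundleOn X V' where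
  ι := L.ι
  U i := L.U i ⊓ V'
  le i := inf_le_right
  covers x hx := by
    obtain ⟨i, hi⟩ := L.covers x (h hx)
    exact ⟨i, ⟨hi, hx⟩⟩
  t i j := resU X (le_inf (inf_le_left.trans inf_le_left)
      (inf_le_right.trans inf_le_left)) (L.t i j)
  cocycle i j k := by
    simp only [resU_resU]
    exact L.cocycle_res i j k (h := le_inf (le_inf
      (inf_le_left.trans (inf_le_left.trans inf_le_left))
      (inf_le_left.trans (inf_le_right.trans inf_le_left)))
      (inf_le_right.trans inf_le_left)) _ _ _

/-- Two line bundles are isomorphic iff `L ⊗ M⁻¹` is trivial. -/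
def Isomorphic (L M : LineBundleOn X V) : Prop :=
  IsTrivial (mul L (inv M))

end LineBundleOn


namespace PicAux

open LineBundleOn

variable {X Y : Scheme.{u}}

/-- Pull-back of sections. -/
def mapS (f : Y ⟶ X) {U : X.Opens} {W : Y.Opens} (e : W ≤ f ⁻¹ᵁ U) :
    ↥Γ(X, U) →+* ↥Γ(Y, W) := (f.appLE U W e).hom

lemma resS_resS (X : Scheme.{u}) {U V W : X.Opens} (h1 : W ≤ V) (h2 : V ≤ U) (u : Γ(X, U)) :
    resS X h1 (resS X h2 u) = resS X (h1.trans h2) u := by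
  show (X.presheaf.map (homOfLE h1).op) ((X.presheaf.map (homOfLE h2).op) u) = _
  rw [← CategoryTheory.comp_apply, ← Functor.map_comp, ← op_comp, homOfLE_comp]
  rfl

lemma resS_mapS (f : Y ⟶ X) {U : X.Opens} {W W' : Y.Opens} (e : W ≤ f ⁻¹ᵁ U)
    (h : W' ≤ W) (u : Γ(X, U)) :
    resS Y h (mapS f e u) = mapS f (h.trans e) u := by
  show (Y.presheaf.map (homOfLE h).op) ((f.appLE U W e) u) = (f.appLE U W' _) u
  rw [← CategoryTheory.comp_apply, Scheme.Hom.appLE_map]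

lemma mapS_resS (f : Y ⟶ X) {U U' : X.Opens} {W : Y.Opens} (hU : U' ≤ U)
    (e : W ≤ f ⁻¹ᵁ U') (e' : W ≤ f ⁻¹ᵁ U) (u : Γ(X, U)) :
    mapS f e (resS X hU u) = mapS f e' u := by
  show (f.appLE U' W e) ((X.presheaf.map (homOfLE hU).op) u) = (f.appLE U W e') u
  rw [← CategoryTheory.comp_apply, Scheme.Hom.map_appLE]

lemma sec_ext {U : X.Opens} {a b : Γ(X, U)}
    (h : ∀ x ∈ U, ∃ (W : X.Opens) (hW : W ≤ U), x ∈ W ∧ resS X hW a = resS X hW b) : a = b := by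
  choose W hW hx e using h
  refine X.sheaf.eq_of_locally_eq' (fun x : U => W x.1 x.2) U (fun x => homOfLE (hW x.1 x.2))
    ?_ a b ?_
  · intro x hxU
    exact Opens.mem_iSup.2 ⟨⟨x, hxU⟩, hx x hxU⟩
  · intro x
    exact e x.1 x.2

lemma sec_glue {ι : Type u} {U : X.Opens} (V : ι → X.Opens) (hV : ∀ i, V i ≤ U)
    (hc : ∀ x ∈ U, ∃ i, x ∈ V i) (f : ∀ i, Γ(X, V i))
    (hf : ∀ i j, resS X (inf_le_left : V i ⊓ V j ≤ V i) (f i) =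
      resS X (inf_le_right : V i ⊓ V j ≤ V j) (f j)) :
    ∃ s : Γ(X, U), ∀ i, resS X (hV i) s = f i := by
  obtain ⟨s, hs, -⟩ := X.sheaf.existsUnique_gluing' V U (fun i => homOfLE (hV i))
    (fun x hx => Opens.mem_iSup.2 (hc x hx)) f (fun i j => hf i j)
  exact ⟨s, hs⟩

/-- `σ` is locally the `q`-th power of a lift of `s`. -/
def Rel (iota : Y ⟶ X) (q : ℕ) {U : X.Opens} (s : Γ(Y, iota ⁻¹ᵁ U)) (σ : Γ(X, U)) : Prop :=
  ∀ x ∈ U, ∃ (W : X.Opens) (h : W ≤ U), x ∈ W ∧ ∃ f : Γ(X, W),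
    mapS iota (le_refl (iota ⁻¹ᵁ W)) f = resS Y (iota.preimage_mono h) s ∧ f ^ q = resS X h σ

/-- The `q`-th power of a section depends only on its pull-back. -/
def Good (iota : Y ⟶ X) (q : ℕ) : Prop :=
  ∀ (W : X.Opens) (f g : Γ(X, W)),
    mapS iota (le_refl (iota ⁻¹ᵁ W)) f = mapS iota (le_refl (iota ⁻¹ᵁ W)) g → f ^ q = g ^ q

lemma lift_res (iota : Y ⟶ X) {U W W' : X.Opens} (h : W ≤ U) (h' : W' ≤ W)
    {s : Γ(Y, iota ⁻¹ᵁ U)} {f : Γ(X, W)}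
    (e : mapS iota (le_refl (iota ⁻¹ᵁ W)) f = resS Y (iota.preimage_mono h) s) :
    mapS iota (le_refl (iota ⁻¹ᵁ W')) (resS X h' f) =
      resS Y (iota.preimage_mono (h'.trans h)) s := by
  have := congrArg (resS Y (iota.preimage_mono h')) e
  rw [resS_mapS, resS_resS] at this
  rw [mapS_resS iota h' le_rfl (iota.preimage_mono h'), this]

lemma Rel.unique {iota : Y ⟶ X} {q : ℕ} (H : Good iota q) {U : X.Opens} {s : Γ(Y, iota ⁻¹ᵁ U)}
    {a b : Γ(X, U)} (ha : Rel iota q s a) (hb : Rel iota q s b) : a = b := by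
  apply sec_ext
  intro x hx
  obtain ⟨W, h, hxW, f, hf, hfa⟩ := ha x hx
  obtain ⟨W', h', hxW', g, hg, hgb⟩ := hb x hx
  refine ⟨W ⊓ W', inf_le_left.trans h, ⟨hxW, hxW'⟩, ?_⟩
  have e := H (W ⊓ W') (resS X inf_le_left f) (resS X inf_le_right g)
    (by rw [lift_res iota h inf_le_left hf, lift_res iota h' inf_le_right hg])
  rw [← map_pow, ← map_pow, hfa, hgb, resS_resS, resS_resS] at e
  exact e

lemma Rel.mul {iota : Y ⟶ X} {q : ℕ} {U : X.Opens} {s s' : Γ(Y, iota ⁻¹ᵁ U)}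
    {a b : Γ(X, U)} (ha : Rel iota q s a) (hb : Rel iota q s' b) : Rel iota q (s * s') (a * b) := by
  intro x hx
  obtain ⟨W, h, hxW, f, hf, hfa⟩ := ha x hx
  obtain ⟨W', h', hxW', g, hg, hgb⟩ := hb x hx
  refine ⟨W ⊓ W', inf_le_left.trans h, ⟨hxW, hxW'⟩,
    resS X inf_le_left f * resS X inf_le_right g, ?_, ?_⟩
  · rw [map_mul, lift_res iota h inf_le_left hf, lift_res iota h' inf_le_right hg, map_mul]
  · rw [mul_pow, ← map_pow, ← map_pow, hfa, hgb, resS_resS, resS_resS, map_mul]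

lemma Rel.res {iota : Y ⟶ X} {q : ℕ} {U V : X.Opens} (hV : V ≤ U) {s : Γ(Y, iota ⁻¹ᵁ U)}
    {a : Γ(X, U)} (ha : Rel iota q s a) :
    Rel iota q (resS Y (iota.preimage_mono hV) s) (resS X hV a) := by
  intro x hx
  obtain ⟨W, h, hxW, f, hf, hfa⟩ := ha x (hV hx)
  refine ⟨W ⊓ V, inf_le_right, ⟨hxW, hx⟩, resS X inf_le_left f, ?_, ?_⟩
  · rw [lift_res iota h inf_le_left hf, resS_resS]
  · rw [← map_pow, hfa, resS_resS, resS_resS]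

lemma Rel.of_map (iota : Y ⟶ X) (q : ℕ) {U : X.Opens} (f : Γ(X, U)) :
    Rel iota q (mapS iota (le_refl (iota ⁻¹ᵁ U)) f) (f ^ q) := by
  intro x hx
  refine ⟨U, le_rfl, hx, f, ?_, ?_⟩
  · rw [resS_mapS]
  · have : resS X (le_refl U) = RingHom.id _ := by
      unfold resS
      have : (homOfLE (le_refl U)).op = 𝟙 _ := rfl
      rw [this, CategoryTheory.Functor.map_id]; rfl
    rw [this]; rfl

lemma Rel.one (iota : Y ⟶ X) (q : ℕ) (U : X.Opens) :
    Rel iota q (1 : Γ(Y, iota ⁻¹ᵁ U)) (1 : Γ(X, U)) := by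
  have := Rel.of_map iota q (1 : Γ(X, U))
  rwa [map_one, one_pow] at this

lemma Rel.exists {iota : Y ⟶ X} [IsClosedImmersion iota] {q : ℕ} (H : Good iota q) {U : X.Opens}
    (s : Γ(Y, iota ⁻¹ᵁ U)) : ∃ a : Γ(X, U), Rel iota q s a := by
  have hb : ∀ x : U, ∃ V : X.Opens, IsAffineOpen V ∧ V ≤ U ∧ x.1 ∈ V := by
    intro x
    obtain ⟨_, ⟨V, hV, rfl⟩, hxV, hVU⟩ :=
      X.isBasis_affineOpens.exists_subset_of_mem_open x.2 U.isOpen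
    exact ⟨V, hV, hVU, hxV⟩
  choose V hVa hVU hxV using hb
  have hl : ∀ x : U, ∃ f : Γ(X, V x), mapS iota (le_refl (iota ⁻¹ᵁ V x)) f =
      resS Y (iota.preimage_mono (hVU x)) s := by
    intro x
    obtain ⟨f, hf⟩ := iota.app_surjective (V x) (hVa x) (resS Y (iota.preimage_mono (hVU x)) s)
    refine ⟨f, ?_⟩
    rw [← hf]
    show (iota.appLE _ _ _) f = _
    rw [Scheme.Hom.app_eq_appLE]
  choose f hf using hl
  obtain ⟨a, ha⟩ := sec_glue V hVU (fun x hx => ⟨⟨x, hx⟩, hxV _⟩) (fun x => f x ^ q) (by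
    intro i j
    rw [map_pow, map_pow]
    apply H
    rw [lift_res iota (hVU i) inf_le_left (hf i), lift_res iota (hVU j) inf_le_right (hf j)])
  refine ⟨a, fun x hx => ⟨V ⟨x, hx⟩, hVU _, hxV _, f ⟨x, hx⟩, hf _, (ha _).symm⟩⟩

lemma Rel.exists_unit {iota : Y ⟶ X} [IsClosedImmersion iota] {q : ℕ} (H : Good iota q)
    {U : X.Opens} (s : (Γ(Y, iota ⁻¹ᵁ U))ˣ) :
    ∃ a : (Γ(X, U))ˣ, Rel iota q (s : Γ(Y, iota ⁻¹ᵁ U)) (a : Γ(X, U)) := by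
  obtain ⟨a, ha⟩ := Rel.exists H (s : Γ(Y, iota ⁻¹ᵁ U))
  obtain ⟨b, hb⟩ := Rel.exists H ((s⁻¹ : (Γ(Y, iota ⁻¹ᵁ U))ˣ) : Γ(Y, iota ⁻¹ᵁ U))
  have e : a * b = 1 := by
    have := ha.mul hb
    rw [Units.mul_inv] at this
    exact this.unique H (Rel.one iota q U)
  exact ⟨⟨a, b, e, by rw [mul_comm, e]⟩, ha⟩

lemma trivial_of_good {iota : Y ⟶ X} [IsClosedImmersion iota] {q : ℕ} (H : Good iota q)
    (L : LineBundleOn X ⊤) (htriv : (LineBundleOn.pullback iota L).IsTrivial) :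
    (L.pow q).IsTrivial := by
  have htriv' : ∃ s : ∀ i : L.ι, (Γ(Y, iota ⁻¹ᵁ L.U i))ˣ, ∀ i j : L.ι,
      mapU iota (preimage_inf_le iota (L.U i) (L.U j)) (L.t i j) =
        resU Y inf_le_left (s i) * (resU Y inf_le_right (s j))⁻¹ := htriv
  clear htriv
  obtain ⟨s, hs⟩ := htriv'
  suffices h : ∃ σ : ∀ i : L.ι, (Γ(X, L.U i))ˣ, ∀ i j : L.ι,
      (L.t i j) ^ q = resU X inf_le_left (σ i) * (resU X inf_le_right (σ j))⁻¹ from h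
  choose σ hσ using fun i => Rel.exists_unit H (s i)
  refine ⟨σ, fun i j => ?_⟩
  rw [eq_mul_inv_iff_mul_eq]
  have e := hs i j
  rw [eq_mul_inv_iff_mul_eq] at e
  have hle : iota ⁻¹ᵁ (L.U i ⊓ L.U j) ≤ iota ⁻¹ᵁ L.U i ⊓ iota ⁻¹ᵁ L.U j := fun x hx => hx
  have e2 := congrArg (fun u => resS Y hle (Units.val u)) e
  have e3 : mapS iota (le_refl (iota ⁻¹ᵁ (L.U i ⊓ L.U j))) (L.t i j).1 *
      resS Y (iota.preimage_mono inf_le_right) (s j).1 =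
      resS Y (iota.preimage_mono inf_le_left) (s i).1 := by
    have a1 : resS Y hle (mapS iota (preimage_inf_le iota (L.U i) (L.U j)) (L.t i j).1 *
      resS Y inf_le_right (s j).1) = resS Y hle (resS Y inf_le_left (s i).1) := e2
    rw [map_mul, resS_mapS, resS_resS, resS_resS] at a1
    exact a1
  apply Units.ext
  have r1 := (Rel.of_map iota q (L.t i j).1).mul ((hσ j).res (inf_le_right : L.U i ⊓ L.U j ≤ _))
  have r2 := (hσ i).res (inf_le_left : L.U i ⊓ L.U j ≤ _)
  have e3' := e3
  rw [← e3'] at r2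
  exact r1.unique H r2

lemma pow_eq_zero_of_away {A B : Type*} [CommRing A] [CommRing B] [Algebra A B] (a : A)
    [IsLocalization.Away a B] {N : ℕ} (hN : nilradical A ^ N = ⊥) {b : B} (hb : IsNilpotent b) :
    b ^ N = 0 := by
  obtain ⟨x, y, rfl⟩ := IsLocalization.exists_mk'_eq (Submonoid.powers a) b
  obtain ⟨m, hm⟩ := hb
  rw [← IsLocalization.mk'_pow, IsLocalization.mk'_eq_zero_iff] at hm
  obtain ⟨c, hc⟩ := hm
  rw [← IsLocalization.mk'_pow, IsLocalization.mk'_eq_zero_iff]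
  refine ⟨c ^ N, ?_⟩
  have hn : (c : A) * x ∈ nilradical A := by
    refine ⟨m + 1, ?_⟩
    have : ((c : A) * x) ^ (m + 1) = c ^ m * x * (c * x ^ m) := by ring
    show ((c : A) * x) ^ (m + 1) = 0
    rw [this, hc, mul_zero]
  have := Ideal.pow_mem_pow hn N
  rw [hN, Ideal.mem_bot, mul_pow] at this
  simpa using this

lemma exists_nilp [AlgebraicGeometry.IsNoetherian X] (iota : Y ⟶ X)
    (hsurj : Function.Surjective iota.base) :
    ∃ N : ℕ, ∀ (W : X.Opens) (f : Γ(X, W)),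
      mapS iota (le_refl (iota ⁻¹ᵁ W)) f = 0 → f ^ N = 0 := by
  have hb : ∀ x : X, ∃ V : X.Opens, IsAffineOpen V ∧ x ∈ V := by
    intro x
    obtain ⟨_, ⟨V, hV, rfl⟩, hxV, -⟩ :=
      X.isBasis_affineOpens.exists_subset_of_mem_open (Set.mem_univ x) isOpen_univ
    exact ⟨V, hV, hxV⟩
  choose V hVa hxV using hb
  obtain ⟨t, ht⟩ := CompactSpace.elim_nhds_subcover (fun x => (V x : Set X))
    (fun x => (V x).isOpen.mem_nhds (hxV x))
  have hn : ∀ x, ∃ N, nilradical Γ(X, V x) ^ N = ⊥ := by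
    intro x
    have : IsNoetherianRing Γ(X, V x) :=
      IsLocallyNoetherian.component_noetherian ⟨V x, hVa x⟩
    exact IsNoetherianRing.isNilpotent_nilradical _
  choose N hN using hn
  refine ⟨t.sup N, fun W f hf => sec_ext fun x hx => ?_⟩
  have hxt : x ∈ ⋃ y ∈ t, (V y : Set X) := by rw [ht]; trivial
  simp only [Set.mem_iUnion] at hxt
  obtain ⟨y, hyt, hxy⟩ := hxt
  obtain ⟨a, haW, hxa⟩ := (hVa y).exists_basicOpen_le ⟨x, hx⟩ hxy
  refine ⟨X.basicOpen a, haW, hxa, ?_⟩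
  have hnil : IsNilpotent (resS X haW f) := by
    rw [Scheme.isNilpotent_iff_basicOpen_eq_bot_of_isCompact ((hVa y).basicOpen a).isCompact]
    have h0 : X.basicOpen f = ⊥ := by
      have h1 : iota ⁻¹ᵁ X.basicOpen f = ⊥ := by
        rw [Scheme.preimage_basicOpen, Scheme.Hom.app_eq_appLE]
        have : (iota.appLE W (iota ⁻¹ᵁ W) le_rfl) f = 0 := hf
        rw [this, Scheme.basicOpen_zero]
      rw [eq_bot_iff]
      intro z hz
      obtain ⟨w, rfl⟩ := hsurj z
      have : w ∈ iota ⁻¹ᵁ X.basicOpen f := hz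
      rw [h1] at this
      exact this.elim
    have h2 := X.basicOpen_res f (homOfLE haW).op
    rw [h0, inf_bot_eq] at h2
    exact h2
  have := (hVa y).isLocalization_basicOpen a
  have hz := pow_eq_zero_of_away a (hN y) hnil
  rw [map_zero, map_pow]
  exact pow_eq_zero_of_le (Finset.le_sup hyt) hz

lemma pow_sub_of_hom {k R : Type*} [Field k] (p : ℕ) [CharP k p] [Fact p.Prime] [CommRing R]
    (φ : k →+* R) (n : ℕ) (x y : R) : (x - y) ^ p ^ n = x ^ p ^ n - y ^ p ^ n := by
  rcases subsingleton_or_nontrivial R with h | h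
  · exact Subsingleton.elim _ _
  · have : CharP R p := charP_of_injective_ringHom φ.injective p
    exact sub_pow_char_pow ..

lemma exists_good [AlgebraicGeometry.IsNoetherian X] (iota : Y ⟶ X)
    (hsurj : Function.Surjective iota.base) (k : Type u) [Field k] (p : ℕ) [CharP k p]
    (hp : 0 < p) (sX : X ⟶ Spec (CommRingCat.of k)) : ∃ n, Good iota (p ^ n) := by
  have : Fact p.Prime := ⟨(CharP.char_is_prime_or_zero k p).resolve_right hp.ne'⟩
  obtain ⟨N, hN⟩ := exists_nilp iota hsurj
  refine ⟨N, fun W f g e => ?_⟩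
  have h0 := hN W (f - g) (by rw [map_sub, e, sub_self])
  have h1 := pow_eq_zero_of_le (Nat.lt_pow_self (Fact.out : p.Prime).one_lt).le h0
  let φ : k →+* Γ(X, W) := (mapS sX (U := ⊤) (W := W) le_top).comp
    (Scheme.ΓSpecIso (CommRingCat.of k)).inv.hom
  rw [pow_sub_of_hom p φ, sub_eq_zero] at h1
  exact h1

end PicAux


open LineBundleOn in
/-- Let `k` be a field of positive characteristic `p` and `X` a Noetherian `k`-scheme
with reduction `X_red` (the reduced closed subscheme with the same underlying space).
Then the kernel of the restriction map `Pic(X) → Pic(X_red)` is killed by some power of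
`p`: for every line bundle `L` on `X` whose restriction to `X_red` is trivial there is
an `n` such that `L^{⊗ pⁿ}` is trivial. -/
theorem stmt_1 (k : Type u) [Field k] (p : ℕ) [CharP k p] (hp : 0 < p)
    (X : Scheme.{u}) [AlgebraicGeometry.IsNoetherian X]
    (sX : X ⟶ Spec (CommRingCat.of k))
    (Xred : Scheme.{u}) (iota : Xred ⟶ X) (hcl : IsClosedImmersion iota)
    (hred : IsReduced Xred) (hsurj : Function.Surjective iota.base)
    (L : LineBundleOn X ⊤) (htriv : (LineBundleOn.pullback iota L).IsTrivial) :
    ∃ n : ℕ, (L.pow (p ^ n)).IsTrivial := by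
  obtain ⟨n, hn⟩ := PicAux.exists_good iota hsurj k p hp sX
  exact ⟨n, PicAux.trivial_of_good hn L htriv⟩

end LocalPic
end

section
/- Let k be a field of positive characteristic p and g : Y -> X a finite universal homeomorphism of Noetherian k-schemes. Then the kernel of the pull-back map g^* : Pic(X) -> Pic(Y) is killed by some power of p. -/
open AlgebraicGeometry CategoryTheory Opposite TopologicalSpace

universe u

namespace LocalPic

/-- A morphism of schemes is a universal homeomorphism if every base change of it is a
homeomorphism on underlying topological spaces. -/
def IsUnivHomeomorph {X Y : Scheme.{u}} (f : X ⟶ Y) : Prop :=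
  ∀ (Z : Scheme.{u}) (g : Z ⟶ Y), IsHomeomorph ⇑(Limits.pullback.snd f g).base


section ringpart

open TensorProduct

lemma charp_add_pow {R : Type*} [CommRing R] {p : ℕ} (hp : p.Prime) (h : (p : R) = 0)
    (x y : R) (n : ℕ) : (x + y) ^ p ^ n = x ^ p ^ n + y ^ p ^ n := by
  cases subsingleton_or_nontrivial R
  · exact Subsingleton.elim _ _
  · have := Fact.mk hp
    have : CharP R p := by
      obtain ⟨q, hq⟩ := CharP.exists R
      have h1 : q ∣ p := (CharP.cast_eq_zero_iff R q p).1 h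
      rcases (Nat.dvd_prime hp).1 h1 with rfl | rfl
      · exact absurd hq (fun hq => CharP.char_ne_one R 1 rfl)
      · exact hq
    exact add_pow_char_pow x y p n

lemma charp_sub_pow {R : Type*} [CommRing R] {p : ℕ} (hp : p.Prime) (h : (p : R) = 0)
    (x y : R) (n : ℕ) : (x - y) ^ p ^ n = x ^ p ^ n - y ^ p ^ n := by
  rw [eq_sub_iff_add_eq, ← charp_add_pow hp h, sub_add_cancel]

lemma charp_sum_pow {R : Type*} [CommRing R] {p : ℕ} (hp : p.Prime) (h : (p : R) = 0)
    {ι : Type*} (s : Finset ι) (f : ι → R) (n : ℕ) :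
    (∑ i ∈ s, f i) ^ p ^ n = ∑ i ∈ s, f i ^ p ^ n := by
  classical
  induction s using Finset.induction_on with
  | empty => simp [hp.ne_zero]
  | insert a s ha ih => rw [Finset.sum_insert ha, Finset.sum_insert ha, charp_add_pow hp h, ih]

lemma pow_isNilpotent {R : Type*} [CommRing R] {p : ℕ} (hp : p.Prime) {x : R}
    (h : IsNilpotent x) : ∃ n, x ^ p ^ n = 0 := by
  obtain ⟨m, hm⟩ := h
  exact ⟨m, pow_eq_zero_of_le (Nat.lt_pow_self hp.one_lt).le hm⟩

lemma field_descent {K F : Type*} [Field K] [CommRing F] [Algebra K F] (c : F)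
    (h : c ⊗ₜ[K] (1 : F) = 1 ⊗ₜ[K] c) : ∃ z : K, algebraMap K F z = c := by
  by_contra hc
  have hmem : c ∉ Submodule.span K {(1 : F)} := by
    intro hm
    obtain ⟨z, hz⟩ := Submodule.mem_span_singleton.1 hm
    exact hc ⟨z, by rw [Algebra.algebraMap_eq_smul_one, hz]⟩
  obtain ⟨f, hf1, hf2⟩ := Submodule.exists_le_ker_of_notMem hmem
  have h1 : f 1 = 0 := hf2 (Submodule.mem_span_singleton_self _)
  have := congrArg (TensorProduct.lid K F ∘ LinearMap.rTensor F f) h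
  simp [h1, hf1] at this
  have : Subsingleton F := subsingleton_of_zero_eq_one this.symm
  exact hc ⟨0, Subsingleton.elim _ _⟩

variable {A B : Type u} [CommRing A] [CommRing B] [Algebra A B]

lemma fiber_zero (P : Ideal A) [P.IsPrime] (x : B)
    (hx : (1 : P.ResidueField) ⊗ₜ[A] x = 0) :
    ∃ s ∉ P, algebraMap A B s * x ∈ P.map (algebraMap A B) := by
  let _ : Algebra B (P.Fiber B) := Algebra.TensorProduct.rightAlgebra
  have h1 : algebraMap B (P.Fiber B) x = 0 := hx
  have h2 := (Ideal.Fiber.algEquivAux₁ (S := B) P).commutes x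
  rw [h1, map_zero] at h2
  have h3 : algebraMap B (Localization (Algebra.algebraMapSubmonoid B P.primeCompl)) x ∈
    (P.map (algebraMap A B)).map (algebraMap B _) := Ideal.Quotient.eq_zero_iff_mem.1 h2.symm
  rw [IsLocalization.algebraMap_mem_map_algebraMap_iff
    (Algebra.algebraMapSubmonoid B P.primeCompl)] at h3
  obtain ⟨_, ⟨s, hs, rfl⟩, h⟩ := h3
  exact ⟨s, hs, h⟩

lemma prime_step (P : Ideal A) [P.IsPrime] (c : B) (h : c ⊗ₜ[A] (1 : B) = 1 ⊗ₜ[A] c) :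
    ∃ s ∉ P, ∃ a : A, algebraMap A B s * c - algebraMap A B a ∈ P.map (algebraMap A B) := by
  let K := P.ResidueField
  let F := K ⊗[A] B
  let i : B →ₐ[A] F := Algebra.TensorProduct.includeRight
  let φ : B ⊗[A] B →ₐ[A] F ⊗[K] F := Algebra.TensorProduct.lift
    (((Algebra.TensorProduct.includeLeft : F →ₐ[K] F ⊗[K] F).restrictScalars A).comp i)
    (((Algebra.TensorProduct.includeRight : F →ₐ[K] F ⊗[K] F).restrictScalars A).comp i)
    (fun _ _ => Commute.all _ _)
  have h1 := congrArg φ h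
  have h2 : (i c) ⊗ₜ[K] (1 : F) = 1 ⊗ₜ[K] (i c) := by simpa [φ] using h1
  obtain ⟨z, hz⟩ := field_descent _ h2
  obtain ⟨x, y, hy, hxy⟩ := IsFractionRing.div_surjective (A := A ⧸ P) z
  obtain ⟨a, rfl⟩ := Ideal.Quotient.mk_surjective x
  obtain ⟨s, rfl⟩ := Ideal.Quotient.mk_surjective y
  have hy0 := nonZeroDivisors.ne_zero hy
  have hs : s ∉ P := fun hs => hy0 (Ideal.Quotient.eq_zero_iff_mem.2 hs)
  have hz2 : algebraMap A K s * z = algebraMap A K a := by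
    rw [← hxy]
    have : algebraMap A K s ≠ 0 := by simpa [K] using hs
    exact mul_div_cancel₀ _ this
  have h0 : (1 : K) ⊗ₜ[A] (algebraMap A B s * c - algebraMap A B a) = 0 := by
    have e1 : i (algebraMap A B s * c - algebraMap A B a) = 0 := by
      rw [map_sub, map_mul, AlgHom.commutes, AlgHom.commutes, ← hz,
        IsScalarTower.algebraMap_apply A K F, IsScalarTower.algebraMap_apply A K F, ← map_mul, hz2,
        sub_self]
    exact e1
  obtain ⟨s', hs', h'⟩ := fiber_zero P _ h0
  refine ⟨s' * s, fun hm => (Ideal.IsPrime.mem_or_mem ‹_› hm).elim hs' hs, s' * a, ?_⟩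
  convert h' using 1
  simp only [map_mul]; ring

lemma exists_pow_tmul {p : ℕ} (hp : p.Prime) (hA : (p : A) = 0)
    (hinj : ∀ (K : Type u) [Field K] (f g : B →+* K),
      f.comp (algebraMap A B) = g.comp (algebraMap A B) → f = g) (b : B) :
    ∃ n, (b ^ p ^ n) ⊗ₜ[A] (1 : B) = 1 ⊗ₜ[A] (b ^ p ^ n) := by
  have hnil : IsNilpotent (b ⊗ₜ[A] (1 : B) - 1 ⊗ₜ[A] b) := by
    rw [← mem_nilradical, nilradical_eq_sInf, Submodule.mem_sInf]
    intro (P : Ideal (B ⊗[A] B)) hP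
    have : P.IsPrime := hP
    have := hinj P.ResidueField
      ((algebraMap (B ⊗[A] B) P.ResidueField).comp
        (Algebra.TensorProduct.includeLeft : B →ₐ[A] B ⊗[A] B).toRingHom)
      ((algebraMap (B ⊗[A] B) P.ResidueField).comp
        (Algebra.TensorProduct.includeRight : B →ₐ[A] B ⊗[A] B).toRingHom) (by
          ext a
          simp [Algebra.TensorProduct.tmul_one_eq_one_tmul])
    have h := RingHom.congr_fun this b
    rw [← Ideal.algebraMap_residueField_eq_zero, map_sub, sub_eq_zero]
    exact h
  obtain ⟨n, hn⟩ := pow_isNilpotent hp hnil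
  refine ⟨n, ?_⟩
  have h0 : ((p : ℕ) : B ⊗[A] B) = 0 := by
    rw [← map_natCast (algebraMap A (B ⊗[A] B)), hA, map_zero]
  rw [charp_sub_pow hp h0, sub_eq_zero] at hn
  simpa [Algebra.TensorProduct.tmul_pow] using hn

lemma contraction (hsurj : ∀ P : Ideal A, P.IsPrime →
      ∃ Q : Ideal B, Q.IsPrime ∧ Q.comap (algebraMap A B) = P)
    (I : Ideal A) (a : A) (ha : algebraMap A B a ∈ I.map (algebraMap A B)) : a ∈ I.radical := by
  rw [Ideal.radical_eq_sInf, Submodule.mem_sInf]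
  rintro P ⟨hIP, hP⟩
  obtain ⟨Q, hQ, rfl⟩ := hsurj P hP
  exact Ideal.map_le_iff_le_comap.2 hIP ha

lemma pow_uniform [Module.Finite A B] {p : ℕ} (hp : p.Prime) (hA : (p : A) = 0)
    (E : Subalgebra A B) (h : ∀ b : B, ∃ n, b ^ p ^ n ∈ E) :
    ∃ n, ∀ b : B, b ^ p ^ n ∈ E := by
  classical
  have hB : (p : B) = 0 := by rw [← map_natCast (algebraMap A B), hA, map_zero]
  obtain ⟨S, hS⟩ := Module.Finite.fg_top (R := A) (M := B)
  choose m hm using h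
  let n := S.sup m
  let N : Submodule A B :=
    { carrier := {b | b ^ p ^ n ∈ E}
      add_mem' := fun {x y} hx hy => by
        simp only [Set.mem_ofPred_eq] at *
        rw [charp_add_pow hp hB]
        exact E.add_mem hx hy
      zero_mem' := by
        simp only [Set.mem_ofPred_eq]
        rw [zero_pow (pow_ne_zero _ hp.ne_zero)]
        exact E.zero_mem
      smul_mem' := fun a x hx => by
        simp only [Set.mem_ofPred_eq] at *
        rw [smul_pow]
        exact E.smul_mem hx _ }
  refine ⟨n, fun b => ?_⟩
  have hN : (⊤ : Submodule A B) ≤ N := by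
    rw [← hS, Submodule.span_le]
    intro x hx
    have hle : m x ≤ n := Finset.le_sup hx
    change x ^ p ^ n ∈ E
    rw [← Nat.add_sub_of_le hle, pow_add, pow_mul]
    exact E.pow_mem (hm x) _
  exact hN (Submodule.mem_top (x := b))

lemma prime_uniform [Module.Finite A B] {p : ℕ} (hp : p.Prime) (hA : (p : A) = 0)
    (P : Ideal A) [P.IsPrime] (n : ℕ)
    (h : ∀ b : B, (b ^ p ^ n) ⊗ₜ[A] (1 : B) = 1 ⊗ₜ[A] (b ^ p ^ n)) :
    ∃ s ∉ P, ∀ b : B, ∃ a : A,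
      algebraMap A B s * b ^ p ^ n - algebraMap A B a ∈ P.map (algebraMap A B) := by
  classical
  have hB : (p : B) = 0 := by rw [← map_natCast (algebraMap A B), hA, map_zero]
  obtain ⟨S, hS⟩ := Module.Finite.fg_top (R := A) (M := B)
  choose t ht a ha using fun b => prime_step P _ (h b)
  let s := ∏ b ∈ S, t b
  let N : Submodule A B :=
    { carrier := {b | ∃ a : A,
        algebraMap A B s * b ^ p ^ n - algebraMap A B a ∈ P.map (algebraMap A B)}
      add_mem' := by
        rintro x y ⟨a1, h1⟩ ⟨a2, h2⟩
        refine ⟨a1 + a2, ?_⟩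
        rw [charp_add_pow hp hB]
        convert Ideal.add_mem _ h1 h2 using 1
        rw [map_add]; ring
      zero_mem' := ⟨0, by simp [hp.ne_zero]⟩
      smul_mem' := by
        rintro c x ⟨a1, h1⟩
        refine ⟨c ^ p ^ n * a1, ?_⟩
        convert Ideal.mul_mem_left _ (algebraMap A B (c ^ p ^ n)) h1 using 1
        rw [smul_pow, Algebra.smul_def, map_mul]; ring }
  have hN : (⊤ : Submodule A B) ≤ N := by
    rw [← hS, Submodule.span_le]
    intro x hx
    refine ⟨(∏ b ∈ S.erase x, t b) * a x, ?_⟩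
    convert Ideal.mul_mem_left _ (algebraMap A B (∏ b ∈ S.erase x, t b)) (ha x) using 1
    have : s = t x * ∏ b ∈ S.erase x, t b := (Finset.mul_prod_erase S t hx).symm
    rw [this, map_mul, map_mul]; ring
  refine ⟨s, ?_, fun b => hN (Submodule.mem_top (x := b))⟩
  intro hs
  obtain ⟨x, _, hx2⟩ := (Ideal.IsPrime.prod_mem_iff (p := P)).1 hs
  exact ht x hx2

theorem noeth_ind [IsNoetherianRing A] [Module.Finite A B] {p : ℕ} (hp : p.Prime)
    (hA : (p : A) = 0)
    (hsurj : ∀ P : Ideal A, P.IsPrime →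
      ∃ Q : Ideal B, Q.IsPrime ∧ Q.comap (algebraMap A B) = P)
    (n : ℕ) (h : ∀ b : B, (b ^ p ^ n) ⊗ₜ[A] (1 : B) = 1 ⊗ₜ[A] (b ^ p ^ n))
    (I₀ : Ideal A) : ∀ b : B, ∃ m, ∃ a : A,
      b ^ p ^ m - algebraMap A B a ∈ I₀.map (algebraMap A B) := by
  have hB : (p : B) = 0 := by rw [← map_natCast (algebraMap A B), hA, map_zero]
  refine _root_.IsNoetherian.induction (P := fun I : Ideal A => ∀ b : B, ∃ m, ∃ a : A,
      b ^ p ^ m - algebraMap A B a ∈ I.map (algebraMap A B)) ?_ I₀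
  intro (I : Ideal A) ih b
  by_cases hI : I = ⊤
  · subst hI
    exact ⟨0, 0, by rw [Ideal.map_top]; trivial⟩
  by_cases hP : I.IsPrime
  · obtain ⟨s, hs, hs2⟩ := prime_uniform hp hA I n h
    have hlt : I < I ⊔ Ideal.span {s} := by
      refine lt_of_le_of_ne le_sup_left fun e => hs ?_
      rw [e]
      exact Ideal.mem_sup_right (Ideal.mem_span_singleton_self s)
    obtain ⟨m, a, hm⟩ := ih _ hlt b
    rw [Ideal.map_sup, Ideal.map_span, Set.image_singleton, Submodule.mem_sup] at hm
    obtain ⟨i, hi, y, hy, hiy⟩ := hm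
    obtain ⟨d, rfl⟩ := Ideal.mem_span_singleton'.1 hy
    obtain ⟨a', ha'⟩ := hs2 d
    refine ⟨m + n, a ^ p ^ n + s ^ (p ^ n - 1) * a', ?_⟩
    have e1 : b ^ p ^ (m + n) = i ^ p ^ n + d ^ p ^ n * algebraMap A B s ^ p ^ n
        + algebraMap A B a ^ p ^ n := by
      rw [pow_add, pow_mul, ← mul_pow, ← charp_add_pow hp hB, ← charp_add_pow hp hB, hiy,
        sub_add_cancel]
    have hq : p ^ n ≠ 0 := pow_ne_zero _ hp.ne_zero
    have e2 : algebraMap A B s ^ p ^ n = algebraMap A B s ^ (p ^ n - 1) * algebraMap A B s := by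
      rw [← pow_succ, Nat.sub_add_cancel (Nat.pos_of_ne_zero hq)]
    have e3 : b ^ p ^ (m + n) - algebraMap A B (a ^ p ^ n + s ^ (p ^ n - 1) * a') =
        i ^ p ^ n + algebraMap A B s ^ (p ^ n - 1) *
          (algebraMap A B s * d ^ p ^ n - algebraMap A B a') := by
      rw [e1, e2]; simp only [map_add, map_mul, map_pow]; ring
    rw [e3]
    exact Ideal.add_mem _ (Ideal.pow_mem_of_mem _ hi _ (Nat.pos_of_ne_zero hq))
      (Ideal.mul_mem_left _ _ ha')
  · obtain ⟨x, hx, y, hy, hxy⟩ : ∃ x, x ∉ I ∧ ∃ y, y ∉ I ∧ x * y ∈ I := by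
      by_contra hcon
      push Not at hcon
      refine hP ⟨hI, fun {x y} hxy => ?_⟩
      by_contra hc
      push Not at hc
      exact hcon x hc.1 y hc.2 hxy
    have hlt : ∀ s ∉ I, I < I ⊔ Ideal.span {s} := by
      intro s hs
      refine lt_of_le_of_ne le_sup_left fun e => hs ?_
      rw [e]
      exact Ideal.mem_sup_right (Ideal.mem_span_singleton_self s)
    set J1 := I ⊔ Ideal.span {x} with hJ1
    set J2 := I ⊔ Ideal.span {y} with hJ2
    have hJ : J1 * J2 ≤ I := by
      rw [hJ1, hJ2, Ideal.sup_mul, Ideal.mul_sup, Ideal.mul_sup, Ideal.span_singleton_mul_span_singleton]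
      refine sup_le (sup_le Ideal.mul_le_left Ideal.mul_le_left) (sup_le Ideal.mul_le_right ?_)
      rw [Ideal.span_le]; simpa using hxy
    obtain ⟨m1, a1, h1⟩ := ih J1 (hlt x hx) b
    obtain ⟨m2, a2, h2⟩ := ih J2 (hlt y hy) b
    have up : ∀ (J : Ideal A) (m r : ℕ) (a : A),
        b ^ p ^ m - algebraMap A B a ∈ J.map (algebraMap A B) →
        b ^ p ^ (m + r) - algebraMap A B (a ^ p ^ r) ∈ J.map (algebraMap A B) := by
      intro J m r a hJ
      rw [pow_add, pow_mul, map_pow, ← charp_sub_pow hp hB]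
      exact Ideal.pow_mem_of_mem _ hJ _ (Nat.pos_of_ne_zero (pow_ne_zero _ hp.ne_zero))
    have k1 := up J1 m1 m2 a1 h1
    have k2 := up J2 m2 m1 a2 h2
    rw [add_comm m2 m1] at k2
    have hdiff : algebraMap A B (a1 ^ p ^ m2 - a2 ^ p ^ m1) ∈ (J1 ⊔ J2).map (algebraMap A B) := by
      rw [Ideal.map_sup]
      have := Ideal.sub_mem _ (Ideal.mem_sup_right (S := J1.map (algebraMap A B)) k2)
        (Ideal.mem_sup_left (T := J2.map (algebraMap A B)) k1)
      convert this using 1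
      rw [map_sub]; ring
    obtain ⟨r, hr⟩ := contraction hsurj _ _ hdiff
    have hr2 : (a1 ^ p ^ m2 - a2 ^ p ^ m1) ^ p ^ r ∈ J1 ⊔ J2 :=
      Ideal.pow_mem_of_pow_mem _ hr (Nat.lt_pow_self hp.one_lt).le
    rw [charp_sub_pow hp hA, Submodule.mem_sup] at hr2
    obtain ⟨j1, hj1, j2, hj2, hj⟩ := hr2
    have l1 := up J1 _ r _ k1
    have l2 := up J2 _ r _ k2
    set c := b ^ p ^ (m1 + m2 + r) with hc
    set a := (a1 ^ p ^ m2) ^ p ^ r - j1 with ha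
    have ha2 : a = (a2 ^ p ^ m1) ^ p ^ r + j2 := by linear_combination -hj
    have n1 : c - algebraMap A B a ∈ J1.map (algebraMap A B) := by
      convert Ideal.add_mem _ l1 (Ideal.mem_map_of_mem _ hj1) using 1
      rw [ha, map_sub]; ring
    have n2 : c - algebraMap A B a ∈ J2.map (algebraMap A B) := by
      convert Ideal.sub_mem _ l2 (Ideal.mem_map_of_mem _ hj2) using 1
      rw [ha2, map_add]; ring
    have n3 : (c - algebraMap A B a) ^ 2 ∈ I.map (algebraMap A B) := by
      rw [pow_two]
      refine Ideal.map_mono hJ ?_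
      rw [Ideal.map_mul]
      exact Ideal.mul_mem_mul n1 n2
    refine ⟨m1 + m2 + r + 1, a ^ p ^ 1, ?_⟩
    rw [pow_add, pow_mul, ← hc, map_pow, ← charp_sub_pow hp hB, pow_one]
    exact Ideal.pow_mem_of_pow_mem _ n3 hp.two_le

theorem ring_main [IsNoetherianRing A] [Module.Finite A B] {p : ℕ} (hp : p.Prime)
    (hA : (p : A) = 0)
    (hinj : ∀ (K : Type u) [Field K] (f g : B →+* K),
      f.comp (algebraMap A B) = g.comp (algebraMap A B) → f = g)
    (hsurj : ∀ P : Ideal A, P.IsPrime →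
      ∃ Q : Ideal B, Q.IsPrime ∧ Q.comap (algebraMap A B) = P) :
    ∃ n, (∀ b : B, ∃ a : A, algebraMap A B a = b ^ p ^ n) ∧
      ∀ a : A, algebraMap A B a = 0 → a ^ p ^ n = 0 := by
  let E : Subalgebra A B := AlgHom.equalizer
    (Algebra.TensorProduct.includeLeft : B →ₐ[A] B ⊗[A] B)
    (Algebra.TensorProduct.includeRight : B →ₐ[A] B ⊗[A] B)
  obtain ⟨n, hn⟩ := pow_uniform hp hA E (exists_pow_tmul hp hA hinj)
  have h0 := noeth_ind hp hA hsurj n hn ⊥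
  obtain ⟨m, hm⟩ := pow_uniform hp hA (⊥ : Subalgebra A B) (by
    intro b
    obtain ⟨m, a, h⟩ := h0 b
    rw [Ideal.map_bot, Ideal.mem_bot, sub_eq_zero] at h
    exact ⟨m, Algebra.mem_bot.2 ⟨a, h.symm⟩⟩)
  obtain ⟨r, hr⟩ := IsNoetherianRing.isNilpotent_nilradical A
  refine ⟨m + r, fun b => ?_, fun a ha => ?_⟩
  · obtain ⟨a, ha⟩ := Algebra.mem_bot.1 (hm b)
    exact ⟨a ^ p ^ r, by rw [map_pow, ha, pow_add, pow_mul]⟩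
  · have : a ∈ nilradical A := contraction hsurj ⊥ a (by rw [ha]; exact Ideal.zero_mem _)
    have h2 : a ^ r = 0 := by
      have := Ideal.pow_mem_pow this r
      rwa [hr] at this
    refine pow_eq_zero_of_le ((Nat.lt_pow_self hp.one_lt).le.trans
      (Nat.pow_le_pow_right hp.pos (Nat.le_add_left r m))) h2

/-- passing to localizations -/
theorem loc_main {p n : ℕ} {A' B' : Type u} [CommRing A'] [CommRing B']
    [Algebra A A'] [Algebra B B'] (f : A) (φ : A' →+* B')
    (hφ : ∀ a, φ (algebraMap A A' a) = algebraMap B B' (algebraMap A B a))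
    [IsLocalization.Away f A'] [IsLocalization.Away (algebraMap A B f) B']
    (h1 : ∀ b : B, ∃ a : A, algebraMap A B a = b ^ p ^ n)
    (h2 : ∀ a : A, algebraMap A B a = 0 → a ^ p ^ n = 0) :
    (∀ b : B', ∃ a : A', φ a = b ^ p ^ n) ∧ ∀ a : A', φ a = 0 → a ^ p ^ n = 0 := by
  have hfu : IsUnit (algebraMap A A' f) := IsLocalization.Away.algebraMap_isUnit f
  have hfu' : IsUnit (φ (algebraMap A A' f)) := hfu.map φ
  constructor
  · intro b
    obtain ⟨k, b0, hb⟩ := IsLocalization.Away.surj (algebraMap A B f) b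
    obtain ⟨a0, ha0⟩ := h1 b0
    obtain ⟨u, hu⟩ := hfu
    refine ⟨algebraMap A A' a0 * (↑(u⁻¹) : A') ^ (k * p ^ n), ?_⟩
    rw [← hφ, ← hu] at hb
    rw [map_mul, map_pow, hφ, ha0, map_pow, ← hb, mul_pow, ← pow_mul, mul_assoc, ← mul_pow,
      ← map_mul]
    simp
  · intro a ha
    obtain ⟨k, a0, hk⟩ := IsLocalization.Away.surj f a
    have e : algebraMap B B' (algebraMap A B a0) = algebraMap B B' 0 := by
      rw [← hφ, ← hk, map_mul, ha, zero_mul, map_zero]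
    obtain ⟨l, hl⟩ := IsLocalization.Away.exists_of_eq (algebraMap A B f) e
    rw [mul_zero, ← map_pow, ← map_mul] at hl
    have h3 := congrArg (algebraMap A A') (h2 _ hl)
    rw [map_pow, map_mul, ← hk, map_zero, map_pow, mul_pow, mul_pow] at h3
    have u1 : IsUnit ((algebraMap A A' f ^ l) ^ p ^ n) := (hfu.pow _).pow _
    have u2 : IsUnit ((algebraMap A A' f ^ k) ^ p ^ n) := (hfu.pow _).pow _
    rw [u1.mul_right_eq_zero, u2.mul_left_eq_zero] at h3
    exact h3

end ringpart

section schemepart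

variable {X Y : Scheme.{u}} (g : Y ⟶ X) (p : ℕ)

/-- `g^*` on sections over `V` is surjective up to `p^n`-th powers with kernel killed by
`p^n`-th powers. -/
def PGood (n : ℕ) (V : X.Opens) : Prop :=
  (∀ b : Γ(Y, g ⁻¹ᵁ V), ∃ a : Γ(X, V), (g.app V).hom a = b ^ p ^ n) ∧
    ∀ a : Γ(X, V), (g.app V).hom a = 0 → a ^ p ^ n = 0

variable {g p}

lemma PGood.mono {n m : ℕ} {V : X.Opens} (h : PGood g p n V) (hnm : n ≤ m)
    (hp : p.Prime) : PGood g p m V := by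
  obtain ⟨r, rfl⟩ := Nat.exists_eq_add_of_le hnm
  refine ⟨fun b => ?_, fun a ha => ?_⟩
  · obtain ⟨a, ha⟩ := h.1 b
    exact ⟨a ^ p ^ r, by rw [map_pow, ha, pow_add, pow_mul]⟩
  · rw [pow_add, pow_mul, h.2 a ha]
    exact zero_pow (pow_ne_zero _ hp.ne_zero)

lemma PGood.basicOpen [IsAffineHom g] {n : ℕ} {V : X.Opens} (hV : IsAffineOpen V)
    (h : PGood g p n V) (f : Γ(X, V)) : PGood g p n (X.basicOpen f) := by
  let _ : Algebra Γ(X, V) Γ(X, X.basicOpen f) :=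
    (X.presheaf.map (homOfLE (X.basicOpen_le f)).op).hom.toAlgebra
  have hle : g ⁻¹ᵁ X.basicOpen f ≤ g ⁻¹ᵁ V := fun x hx => X.basicOpen_le f hx
  let _ : Algebra Γ(Y, g ⁻¹ᵁ V) Γ(Y, g ⁻¹ᵁ X.basicOpen f) :=
    (Y.presheaf.map (homOfLE hle).op).hom.toAlgebra
  let _ : Algebra Γ(X, V) Γ(Y, g ⁻¹ᵁ V) := (g.app V).hom.toAlgebra
  have : IsLocalization.Away f Γ(X, X.basicOpen f) :=
    hV.isLocalization_of_eq_basicOpen f (homOfLE (X.basicOpen_le f)) rfl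
  have : IsLocalization.Away (algebraMap Γ(X, V) Γ(Y, g ⁻¹ᵁ V) f) Γ(Y, g ⁻¹ᵁ X.basicOpen f) :=
    (hV.preimage g).isLocalization_of_eq_basicOpen _ (homOfLE hle)
      (Scheme.preimage_basicOpen g f)
  refine loc_main (A := Γ(X, V)) (B := Γ(Y, g ⁻¹ᵁ V)) f (g.app (X.basicOpen f)).hom ?_ h.1 h.2
  intro a
  exact ConcreteCategory.congr_hom (g.naturality (homOfLE (X.basicOpen_le f)).op) a

lemma PGood.of_affine [AlgebraicGeometry.IsNoetherian X] [IsFinite g] [UniversallyInjective g] [Surjective g]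
    (hp : p.Prime) (V : X.Opens) (hV : IsAffineOpen V) (h0 : (p : Γ(X, V)) = 0) :
    ∃ n, PGood g p n V := by
  let _ : Algebra Γ(X, V) Γ(Y, g ⁻¹ᵁ V) := (g.app V).hom.toAlgebra
  have hfin : Module.Finite Γ(X, V) Γ(Y, g ⁻¹ᵁ V) := g.finite_app V hV
  have : IsNoetherianRing Γ(X, V) := IsLocallyNoetherian.component_noetherian ⟨V, hV⟩
  have hW : IsAffineOpen (g ⁻¹ᵁ V) := hV.preimage g
  have hsq : Spec.map (g.app V) ≫ hV.fromSpec = hW.fromSpec ≫ g := by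
    rw [Scheme.Hom.app_eq_appLE]
    exact IsAffineOpen.SpecMap_appLE_fromSpec g hV hW le_rfl
  refine ring_main hp h0 ?_ ?_
  · intro K _ φ ψ hφψ
    have key := ((tfae_universallyInjective g).out 0 1 rfl rfl).1 ‹_› K
    have h1 : Spec.map (CommRingCat.ofHom φ) ≫ hW.fromSpec =
        Spec.map (CommRingCat.ofHom ψ) ≫ hW.fromSpec := by
      apply key
      simp only [Category.assoc, ← hsq, ← Spec.map_comp_assoc]
      congr 2
      ext1
      exact hφψ
    rw [cancel_mono] at h1
    have h2 := Spec.map_injective h1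
    exact congrArg CommRingCat.Hom.hom h2
  · intro P hP
    let x : Spec Γ(X, V) := ⟨P, hP⟩
    obtain ⟨y, hy⟩ := g.surjective (hV.fromSpec x)
    have hyW : y ∈ g ⁻¹ᵁ V := by
      change g y ∈ V
      rw [hy]
      have : hV.fromSpec x ∈ Set.range hV.fromSpec := ⟨x, rfl⟩
      rwa [hV.range_fromSpec] at this
    have : y ∈ Set.range hW.fromSpec := by rw [hW.range_fromSpec]; exact hyW
    obtain ⟨z, rfl⟩ := this
    have e : hV.fromSpec (Spec.map (g.app V) z) = hV.fromSpec x := by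
      rw [← hy, ← Scheme.Hom.comp_apply, hsq, Scheme.Hom.comp_apply]
    have e2 : Spec.map (g.app V) z = x := hV.fromSpec.isOpenEmbedding.injective e
    exact ⟨z.asIdeal, z.isPrime, congrArg PrimeSpectrum.asIdeal e2⟩

lemma PGood.cover [AlgebraicGeometry.IsNoetherian X] [IsFinite g] [UniversallyInjective g] [Surjective g]
    (hp : p.Prime) (h0 : ∀ V : X.Opens, (p : Γ(X, V)) = 0) :
    ∃ n, ∀ (V : X.Opens) (x : X), x ∈ V → ∃ W ≤ V, x ∈ W ∧ PGood g p n W := by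
  classical
  choose N hN using fun V : X.affineOpens => PGood.of_affine (g := g) hp V.1 V.2 (h0 V.1)
  have hcov : ∀ x : X, ∃ V : X.affineOpens, x ∈ V.1 := by
    intro x
    obtain ⟨_, ⟨V, hV, rfl⟩, hx, _⟩ :=
      X.isBasis_affineOpens.exists_subset_of_mem_open (Set.mem_univ x) isOpen_univ
    exact ⟨⟨V, hV⟩, hx⟩
  choose c hc using hcov
  obtain ⟨S, hS⟩ := isCompact_univ.elim_finite_subcover (fun x : X => ((c x).1 : Set X))
    (fun x => (c x).1.isOpen) (fun x _ => Set.mem_iUnion.2 ⟨x, hc x⟩)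
  refine ⟨S.sup (fun x => N (c x)), fun V x hx => ?_⟩
  obtain ⟨y, hy, hxy⟩ := Set.mem_iUnion₂.1 (hS (Set.mem_univ x))
  obtain ⟨f, hf1, hf2⟩ := (c y).2.exists_basicOpen_le ⟨x, hx⟩ hxy
  exact ⟨_, hf1, hf2, ((hN (c y)).mono (Finset.le_sup (f := fun x => N (c x)) hy) hp).basicOpen (c y).2 f⟩

lemma app_res {V W : X.Opens} (h : W ≤ V) (h' : g ⁻¹ᵁ W ≤ g ⁻¹ᵁ V) (a : Γ(X, V)) :
    (g.app W).hom ((X.presheaf.map (homOfLE h).op).hom a) =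
      (Y.presheaf.map (homOfLE h').op).hom ((g.app V).hom a) :=
  ConcreteCategory.congr_hom (g.naturality (homOfLE h).op) a

lemma ker_global {n : ℕ}
    (H : ∀ (V : X.Opens) (x : X), x ∈ V → ∃ W ≤ V, x ∈ W ∧ PGood g p n W)
    (V : X.Opens) (a : Γ(X, V)) (ha : (g.app V).hom a = 0) : a ^ p ^ n = 0 := by
  choose W hW hxW hg using fun x : V => H V x.1 x.2
  refine X.sheaf.eq_of_locally_eq' W V (fun x => homOfLE (hW x))
    (fun x hx => Opens.mem_iSup.2 ⟨⟨x, hx⟩, hxW _⟩) _ _ fun x => ?_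
  change (X.presheaf.map (homOfLE (hW x)).op).hom (a ^ p ^ n) =
    (X.presheaf.map (homOfLE (hW x)).op).hom 0
  rw [map_pow, map_zero]
  apply (hg x).2
  rw [app_res (hW x) (fun y hy => hW x hy), ha, map_zero]

lemma surj_global {n : ℕ} (hp : p.Prime) (h0 : ∀ V : X.Opens, (p : Γ(X, V)) = 0)
    (H : ∀ (V : X.Opens) (x : X), x ∈ V → ∃ W ≤ V, x ∈ W ∧ PGood g p n W)
    (V : X.Opens) (b : Γ(Y, g ⁻¹ᵁ V)) : ∃ a : Γ(X, V), (g.app V).hom a = b ^ p ^ (n + n) := by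
  choose W hW hxW hg using fun x : V => H V x.1 x.2
  have hW' : ∀ x, g ⁻¹ᵁ W x ≤ g ⁻¹ᵁ V := fun x y hy => hW x hy
  choose a ha using fun x => (hg x).1 ((Y.presheaf.map (homOfLE (hW' x)).op).hom b)
  have hcomp : TopCat.Presheaf.IsCompatible X.presheaf W (fun x => a x ^ p ^ n) := by
    intro x y
    change (X.presheaf.map (homOfLE (inf_le_left : W x ⊓ W y ≤ W x)).op).hom (a x ^ p ^ n) =
      (X.presheaf.map (homOfLE (inf_le_right : W x ⊓ W y ≤ W y)).op).hom (a y ^ p ^ n)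
    rw [map_pow, map_pow, ← sub_eq_zero, ← charp_sub_pow hp (h0 _)]
    apply ker_global H
    rw [map_sub, app_res inf_le_left (fun z hz => hz.1), app_res inf_le_right (fun z hz => hz.2), ha, ha, map_pow, map_pow,
      ← CommRingCat.comp_apply, ← CommRingCat.comp_apply, ← Functor.map_comp, ← Functor.map_comp]
    exact sub_self _
  have hc : V ≤ iSup W := fun x hx => Opens.mem_iSup.2 ⟨⟨x, hx⟩, hxW _⟩
  obtain ⟨α, hα, -⟩ := X.sheaf.existsUnique_gluing' W V (fun x => homOfLE (hW x)) hc _ hcomp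
  obtain ⟨α, rfl⟩ : ∃ α' : Γ(X, V), α' = α := ⟨α, rfl⟩
  refine ⟨α, ?_⟩
  refine Y.sheaf.eq_of_locally_eq' (fun x => g ⁻¹ᵁ W x) (g ⁻¹ᵁ V) (fun x => homOfLE (hW' x))
    (fun y hy => Opens.mem_iSup.2 ⟨⟨g y, hy⟩, hxW ⟨g y, hy⟩⟩) _ _ fun x => ?_
  change (Y.presheaf.map (homOfLE (hW' x)).op).hom _ =
    (Y.presheaf.map (homOfLE (hW' x)).op).hom (b ^ p ^ (n + n))
  rw [← app_res (hW x) (hW' x) α]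
  have e : (X.presheaf.map (homOfLE (hW x)).op).hom α = a x ^ p ^ n := hα x
  rw [e, map_pow, ha, map_pow, ← pow_mul, ← pow_add]

lemma bijective_of_isPullback
    (hu : ∀ (Z : Scheme.{u}) (h : Z ⟶ X), IsHomeomorph ⇑(Limits.pullback.snd g h).base)
    {Y' X' : Scheme.{u}} (i₁ : Y' ⟶ Y) (i₂ : X' ⟶ X) (f' : Y' ⟶ X')
    (h : IsPullback f' i₁ i₂ g) : Function.Bijective f' := by
  have e : h.flip.isoPullback.hom ≫ Limits.pullback.snd g i₂ = f' :=
    h.flip.isoPullback_hom_snd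
  rw [← e]
  have h1 : Function.Bijective (Limits.pullback.snd g i₂) := (hu X' i₂).bijective
  have h2 : Function.Bijective h.flip.isoPullback.hom :=
    (Scheme.homeoOfIso h.flip.isoPullback).bijective
  rw [Scheme.Hom.comp_base]
  exact h1.comp h2

lemma univInj_of
    (hu : ∀ (Z : Scheme.{u}) (h : Z ⟶ X), IsHomeomorph ⇑(Limits.pullback.snd g h).base) :
    UniversallyInjective g :=
  ⟨fun _ _ i₁ i₂ f' h => (bijective_of_isPullback hu i₁ i₂ f' h).1⟩

lemma surj_of
    (hu : ∀ (Z : Scheme.{u}) (h : Z ⟶ X), IsHomeomorph ⇑(Limits.pullback.snd g h).base) :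
    Surjective g :=
  ⟨(bijective_of_isPullback hu _ _ _ IsPullback.of_id_snd).2⟩

lemma cast_zero {k : Type u} [Field k] [CharP k p] (sX : X ⟶ Spec (CommRingCat.of k))
    (V : X.Opens) : (p : Γ(X, V)) = 0 := by
  let φ : k →+* Γ(X, V) := ((Scheme.ΓSpecIso (CommRingCat.of k)).inv ≫
    sX.appLE ⊤ V le_top).hom
  rw [← map_natCast φ, CharP.cast_eq_zero, map_zero]

end schemepart

open LineBundleOn in
/-- Let `k` be a field of positive characteristic `p` and `g : Y ⟶ X` a finite universal
homeomorphism of Noetherian `k`-schemes. Then the kernel of the pull-back map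
`g^* : Pic(X) → Pic(Y)` is killed by some power of `p`. -/
theorem stmt_5 (k : Type u) [Field k] (p : ℕ) [CharP k p] (hp : 0 < p)
    (X Y : Scheme.{u}) [AlgebraicGeometry.IsNoetherian X] [AlgebraicGeometry.IsNoetherian Y]
    (sX : X ⟶ Spec (CommRingCat.of k)) (sY : Y ⟶ Spec (CommRingCat.of k))
    (g : Y ⟶ X) (hfin : IsFinite g) (hcomm : g ≫ sX = sY)
    (huniv : IsUnivHomeomorph g) :
    ∃ n : ℕ, ∀ L : LineBundleOn X ⊤,
      (LineBundleOn.pullback g L).IsTrivial → (L.pow (p ^ n)).IsTrivial := by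
  have hpr : p.Prime := (CharP.char_is_prime_or_zero k p).resolve_right hp.ne'
  have h0 : ∀ V : X.Opens, (p : Γ(X, V)) = 0 := fun V => cast_zero sX V
  have := univInj_of huniv
  have := surj_of huniv
  obtain ⟨n, H⟩ := PGood.cover (g := g) hpr h0
  refine ⟨n + n + n, fun L hL => ?_⟩
  obtain ⟨s, hs⟩ : ∃ s : ∀ i : L.ι, (Γ(Y, g ⁻¹ᵁ L.U i))ˣ, ∀ i j : L.ι,
      mapU g (preimage_inf_le g (L.U i) (L.U j)) (L.t i j) =
        resU Y (inf_le_left : g ⁻¹ᵁ L.U i ⊓ g ⁻¹ᵁ L.U j ≤ g ⁻¹ᵁ L.U i) (s i) *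
          (resU Y (inf_le_right : g ⁻¹ᵁ L.U i ⊓ g ⁻¹ᵁ L.U j ≤ g ⁻¹ᵁ L.U j) (s j))⁻¹ := hL
  choose σ hσ using fun i => surj_global hpr h0 H (L.U i) (s i).val
  choose τ hτ using fun i => surj_global hpr h0 H (L.U i) ((s i)⁻¹).val
  have hunit : ∀ i, σ i ^ p ^ n * τ i ^ p ^ n = 1 := by
    intro i
    have h1 : (σ i * τ i - 1) ^ p ^ n = 0 := by
      apply ker_global H
      rw [map_sub, map_mul, hσ, hτ, ← mul_pow, map_one]
      rw [Units.mul_inv, one_pow, sub_self]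
    rwa [charp_sub_pow hpr (h0 _), one_pow, sub_eq_zero, mul_pow] at h1
  let v : ∀ i, (Γ(X, L.U i))ˣ := fun i =>
    ⟨σ i ^ p ^ n, τ i ^ p ^ n, hunit i, by rw [mul_comm]; exact hunit i⟩
  refine ⟨v, fun (i j : L.ι) => ?_⟩
  rw [eq_mul_inv_iff_mul_eq]
  ext
  change ((L.t i j : (Γ(X, L.U i ⊓ L.U j))ˣ) : Γ(X, L.U i ⊓ L.U j)) ^ p ^ (n + n + n) *
    (X.presheaf.map (homOfLE (inf_le_right : L.U i ⊓ L.U j ≤ L.U j)).op).hom (σ j ^ p ^ n) =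
    (X.presheaf.map (homOfLE (inf_le_left : L.U i ⊓ L.U j ≤ L.U i)).op).hom (σ i ^ p ^ n)
  rw [pow_add p (n + n) n, pow_mul, map_pow, map_pow, ← mul_pow, ← sub_eq_zero, ← charp_sub_pow hpr (h0 _)]
  apply ker_global H
  have hl : g ⁻¹ᵁ (L.U i ⊓ L.U j) ≤ g ⁻¹ᵁ L.U i := fun z hz => hz.1
  have hr : g ⁻¹ᵁ (L.U i ⊓ L.U j) ≤ g ⁻¹ᵁ L.U j := fun z hz => hz.2
  rw [map_sub, map_mul, map_pow, app_res inf_le_left hl, app_res inf_le_right hr, hσ, hσ,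
    map_pow, map_pow, ← mul_pow, sub_eq_zero]
  congr 1
  have e1 : mapU g le_rfl (L.t i j) * resU Y hr (s j) = resU Y hl (s i) :=
    eq_mul_inv_iff_mul_eq.1 (hs i j)
  have e2 := congrArg Units.val e1
  rw [Scheme.Hom.app_eq_appLE]
  exact e2

end LocalPic
end

section
/- Let q : U -> V be a finite surjective morphism of integral normal Noetherian schemes, and let d be the degree of the induced extension of function fields. Then for every line bundle L on V such that q^* L is trivial on U, the power L^{tensor d} is trivial on V. In particular, the kernel of the pull-back map q^* : Pic(V) -> Pic(U) is killed by d, hence consists of torsion elements. -/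
open AlgebraicGeometry CategoryTheory Opposite TopologicalSpace

universe u

namespace LocalPic

/-- The induced map on function fields of a morphism sending the generic point to the
generic point. -/
noncomputable def functionFieldMap {U V : Scheme.{u}} [IrreducibleSpace ↥U]
    [IrreducibleSpace ↥V] (q : U ⟶ V)
    (h : q.base (genericPoint ↥U) = genericPoint ↥V) :
    V.functionField ⟶ U.functionField :=
  eqToHom (congrArg V.presheaf.stalk h.symm) ≫ q.stalkMap (genericPoint ↥U)

/-- The degree of the function field extension induced by a dominant morphism. -/
noncomputable def funcFieldDegree {U V : Scheme.{u}} [IrreducibleSpace ↥U]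
    [IrreducibleSpace ↥V] (q : U ⟶ V)
    (h : q.base (genericPoint ↥U) = genericPoint ↥V) : ℕ :=
  letI := RingHom.toAlgebra (functionFieldMap q h).hom
  Module.finrank ↥V.functionField ↥U.functionField


section Helpers

lemma aux_norm_mem {R K F : Type*} [CommRing R] [IsIntegrallyClosed R] [Field K] [Field F]
    [Algebra R K] [IsFractionRing R K] [Algebra K F] (x : F)
    (hx : ((algebraMap K F).comp (algebraMap R K)).IsIntegralElem x) :
    ∃ r : R, algebraMap R K r = Algebra.norm K x := by
  let : Algebra R F := ((algebraMap K F).comp (algebraMap R K)).toAlgebra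
  have : IsScalarTower R K F := IsScalarTower.of_algebraMap_eq' rfl
  have h : IsIntegral R x := hx
  exact IsIntegrallyClosed.isIntegral_iff.mp (Algebra.isIntegral_norm K h)

lemma aux_finite {A B K F : Type*} [CommRing A] [CommRing B] [Field K] [Field F]
    [Algebra B F] [IsFractionRing B F] [Algebra K F]
    (f : A →+* B) (hf : f.Finite) (g : A →+* K)
    (h : (algebraMap K F).comp g = (algebraMap B F).comp f) : FiniteDimensional K F := by
  let := f.toAlgebra
  let := g.toAlgebra
  let : Algebra A F := ((algebraMap K F).comp g).toAlgebra
  have : IsScalarTower A K F := IsScalarTower.of_algebraMap_eq' rfl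
  have : IsScalarTower A B F := IsScalarTower.of_algebraMap_eq' h
  have : Module.Finite A B := hf
  obtain ⟨s, hs⟩ := (Module.Finite.fg_top : (⊤ : Submodule A B).FG)
  let E : IntermediateField K F := IntermediateField.adjoin K (algebraMap B F '' (s : Set B))
  have : FiniteDimensional K E := by
    have : Finite ↑(algebraMap B F '' (s : Set B)) := (s.finite_toSet.image _).to_subtype
    refine IntermediateField.finiteDimensional_adjoin ?_
    rintro _ ⟨b, -, rfl⟩
    exact ((Algebra.IsIntegral.isIntegral (R := A) b).algebraMap (B := F)).tower_top
  have hB : ∀ b : B, algebraMap B F b ∈ E := by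
    intro b
    have hb : b ∈ Submodule.span A (s : Set B) := by rw [hs]; trivial
    induction hb using Submodule.span_induction with
    | mem x hx => exact IntermediateField.subset_adjoin K _ ⟨x, hx, rfl⟩
    | zero => rw [map_zero]; exact zero_mem _
    | add x y _ _ hx hy => rw [map_add]; exact add_mem hx hy
    | smul a x _ hx =>
      rw [Algebra.smul_def, map_mul, ← IsScalarTower.algebraMap_apply,
        IsScalarTower.algebraMap_apply A K F]
      exact mul_mem (E.algebraMap_mem _) hx
  have hE : E = ⊤ := by
    rw [eq_top_iff]
    intro x _
    obtain ⟨a, b, _, rfl⟩ := IsFractionRing.div_surjective (A := B) x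
    exact div_mem (hB a) (hB b)
  rw [hE] at this
  exact IntermediateField.topEquiv.toLinearEquiv.finiteDimensional

lemma aux_germ_eqToHom (X : Scheme.{u}) {x y : X} (h : x = y) (W : X.Opens) (hx : x ∈ W)
    (hy : y ∈ W) :
    X.presheaf.germ W x hx ≫ eqToHom (congrArg X.presheaf.stalk h) = X.presheaf.germ W y hy := by
  subst h
  simp

lemma aux_gen_mem {X : Scheme.{u}} [IrreducibleSpace X] {W : X.Opens} {x : X} (hx : x ∈ W) :
    genericPoint X ∈ W :=
  ((genericPoint_spec X).mem_open_set_iff W.isOpen).mpr ⟨x, trivial, hx⟩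

lemma aux_ffmap {U V : Scheme.{u}} [IrreducibleSpace ↥U]
    [IrreducibleSpace ↥V] (q : U ⟶ V)
    (h : q.base (genericPoint ↥U) = genericPoint ↥V) (W : V.Opens)
    (hW : genericPoint V ∈ W) (hW' : genericPoint U ∈ q ⁻¹ᵁ W) :
    V.presheaf.germ W _ hW ≫ functionFieldMap q h =
      q.app W ≫ U.presheaf.germ (q ⁻¹ᵁ W) _ hW' := by
  rw [functionFieldMap, ← Category.assoc, aux_germ_eqToHom V h.symm W hW hW']
  exact q.germ_stalkMap W _ hW'

/-- Elements of the function field lying in all the stalks of an open set are sections. -/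
lemma aux_glue (V : Scheme.{u}) [IsIntegral V] (W : V.Opens) (hW : genericPoint V ∈ W)
    (f : V.functionField)
    (hf : ∀ x ∈ W, ∃ r : V.presheaf.stalk x, algebraMap _ V.functionField r = f) :
    ∃ s : Γ(V, W), V.presheaf.germ W _ hW s = f := by
  have key : ∀ x : W, ∃ (A : V.Opens) (_ : A ≤ W) (hx : x.1 ∈ A) (s : Γ(V, A)),
      V.presheaf.germ A _ (aux_gen_mem hx) s = f := by
    rintro ⟨x, hx⟩
    obtain ⟨r, hr⟩ := hf x hx
    obtain ⟨B, hB, s, rfl⟩ := V.presheaf.exists_germ_eq r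
    refine ⟨B ⊓ W, inf_le_right, ⟨hB, hx⟩, V.presheaf.map (homOfLE inf_le_left).op s, ?_⟩
    rw [← hr]
    have : Nonempty B := ⟨⟨x, hB⟩⟩
    rw [Scheme.algebraMap_germ_eq_germToFunctionField, TopCat.Presheaf.germ_res_apply]
  choose A hAW hxA s hs using key
  obtain ⟨t, ht, -⟩ := V.sheaf.existsUnique_gluing' A W (fun x => homOfLE (hAW x))
    (fun x hx => Opens.mem_iSup.mpr ⟨⟨x, hx⟩, hxA ⟨x, hx⟩⟩) s (by
      intro x y
      have hg : genericPoint V ∈ A x ⊓ A y := ⟨aux_gen_mem (hxA x), aux_gen_mem (hxA y)⟩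
      apply germ_injective_of_isIntegral V _ hg
      erw [TopCat.Presheaf.germ_res_apply, TopCat.Presheaf.germ_res_apply]
      exact (hs x).trans (hs y).symm)
  refine ⟨t, ?_⟩
  rw [← hs ⟨_, hW⟩, ← ht ⟨_, hW⟩]
  exact (TopCat.Presheaf.germ_res_apply V.presheaf (homOfLE (hAW ⟨_, hW⟩)) _ _ t).symm

/-- The norm map on function fields. -/
noncomputable def ffNorm {U V : Scheme.{u}} [IsIntegral U] [IsIntegral V] (q : U ⟶ V)
    (h : q.base (genericPoint ↥U) = genericPoint ↥V) :
    U.functionField →* V.functionField :=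
  letI := RingHom.toAlgebra (functionFieldMap q h).hom
  Algebra.norm V.functionField

lemma ffNorm_map {U V : Scheme.{u}} [IsIntegral U] [IsIntegral V] (q : U ⟶ V)
    (h : q.base (genericPoint ↥U) = genericPoint ↥V) (x : V.functionField) :
    ffNorm q h ((functionFieldMap q h).hom x) = x ^ funcFieldDegree q h := by
  let := RingHom.toAlgebra (functionFieldMap q h).hom
  exact Algebra.norm_algebraMap (R := V.functionField) (S := U.functionField) x

lemma aux_mem_preimage {U V : Scheme.{u}} [IrreducibleSpace ↥U]
    [IrreducibleSpace ↥V] (q : U ⟶ V)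
    (h : q.base (genericPoint ↥U) = genericPoint ↥V) {W : V.Opens}
    (hW : genericPoint V ∈ W) : genericPoint U ∈ q ⁻¹ᵁ W := by
  show q.base (genericPoint U) ∈ W
  rw [h]
  exact hW

lemma ffNorm_section {U V : Scheme.{u}} [IsIntegral U] [IsIntegral V]
    (hVnorm : ∀ x : V, IsIntegrallyClosed ↥(V.presheaf.stalk x)) (q : U ⟶ V)
    (hfin : IsFinite q)
    (h : q.base (genericPoint ↥U) = genericPoint ↥V) (W : V.Opens)
    (hW : genericPoint V ∈ W) (s : Γ(U, q ⁻¹ᵁ W)) :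
    ∃ t : Γ(V, W), V.presheaf.germ W _ hW t =
      ffNorm q h (U.presheaf.germ (q ⁻¹ᵁ W) _ (aux_mem_preimage q h hW) s) := by
  apply aux_glue
  intro x hx
  let := RingHom.toAlgebra (functionFieldMap q h).hom
  have := hVnorm x
  refine aux_norm_mem (R := V.presheaf.stalk x) (K := V.functionField)
    (F := U.functionField) _ ?_
  obtain ⟨_, ⟨A, hA, rfl⟩, hxA, hAW⟩ :=
    V.isBasis_affineOpens.exists_subset_of_mem_open hx W.isOpen
  have hAW' : A ≤ W := hAW
  have hgA : genericPoint V ∈ A := aux_gen_mem hxA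
  have hle : q ⁻¹ᵁ A ≤ q ⁻¹ᵁ W := fun y hy => hAW' hy
  obtain ⟨p, hp, hps⟩ := (IsFinite.finite_app q A hA).to_isIntegral
    (U.presheaf.map (homOfLE hle).op s)
  refine ⟨p.map (V.presheaf.germ A x hxA).hom, hp.map _, ?_⟩
  rw [Polynomial.eval₂_map]
  have e1 : ((algebraMap V.functionField U.functionField).comp
      (algebraMap (V.presheaf.stalk x) V.functionField)).comp (V.presheaf.germ A x hxA).hom =
      (U.presheaf.germ (q ⁻¹ᵁ A) _ (aux_mem_preimage q h hgA)).hom.comp (q.app A).hom := by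
    rw [← CommRingCat.hom_comp, ← aux_ffmap q h A hgA]
    ext y
    have : Nonempty A := ⟨⟨x, hxA⟩⟩
    have := Scheme.algebraMap_germ_eq_germToFunctionField V hxA y
    exact congrArg (functionFieldMap q h).hom this
  have e2 : U.presheaf.germ (q ⁻¹ᵁ W) _ (aux_mem_preimage q h hW) s =
      U.presheaf.germ (q ⁻¹ᵁ A) _ (aux_mem_preimage q h hgA)
        (U.presheaf.map (homOfLE hle).op s) :=
    (TopCat.Presheaf.germ_res_apply U.presheaf (homOfLE hle) _ _ s).symm
  rw [e1, e2]
  have := congrArg (U.presheaf.germ (q ⁻¹ᵁ A) _ (aux_mem_preimage q h hgA)).hom hps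
  rw [Polynomial.hom_eval₂, map_zero] at this
  exact this

lemma ffNorm_unit {U V : Scheme.{u}} [IsIntegral U] [IsIntegral V]
    (hVnorm : ∀ x : V, IsIntegrallyClosed ↥(V.presheaf.stalk x)) (q : U ⟶ V)
    (hfin : IsFinite q)
    (h : q.base (genericPoint ↥U) = genericPoint ↥V) (W : V.Opens)
    (s : (Γ(U, q ⁻¹ᵁ W))ˣ) :
    ∃ t : (Γ(V, W))ˣ, ∀ hW : genericPoint V ∈ W, V.presheaf.germ W _ hW t =
      ffNorm q h (U.presheaf.germ (q ⁻¹ᵁ W) _ (aux_mem_preimage q h hW) s) := by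
  by_cases hW : genericPoint V ∈ W
  swap
  · exact ⟨1, fun h => absurd h hW⟩
  obtain ⟨t, ht⟩ := ffNorm_section hVnorm q hfin h W hW s
  obtain ⟨t', ht'⟩ := ffNorm_section hVnorm q hfin h W hW (s⁻¹ : (Γ(U, q ⁻¹ᵁ W))ˣ)
  have e : t * t' = 1 := by
    apply germ_injective_of_isIntegral V _ hW
    rw [map_mul, ht, ht', ← map_mul, ← map_mul, Units.mul_inv, map_one, map_one, map_one]
  exact ⟨⟨t, t', e, by rw [mul_comm, e]⟩, fun _ => ht⟩

lemma funcFieldDegree_pos {U V : Scheme.{u}} [IsIntegral U] [IsIntegral V] (q : U ⟶ V)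
    (hfin : IsFinite q)
    (h : q.base (genericPoint ↥U) = genericPoint ↥V) : 0 < funcFieldDegree q h := by
  let := RingHom.toAlgebra (functionFieldMap q h).hom
  obtain ⟨_, ⟨A, hA, rfl⟩, hxA, -⟩ :=
    V.isBasis_affineOpens.exists_subset_of_mem_open (Set.mem_univ (genericPoint V)) isOpen_univ
  have hgU := aux_mem_preimage q h hxA
  have : Nonempty ↥(q ⁻¹ᵁ A).toScheme := ⟨⟨_, hgU⟩⟩
  have := functionField_isFractionRing_of_isAffineOpen U (q ⁻¹ᵁ A) (hA.preimage q)
  have : FiniteDimensional V.functionField U.functionField :=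
    aux_finite (B := Γ(U, q ⁻¹ᵁ A)) (q.app A).hom (IsFinite.finite_app q A hA)
      (V.presheaf.germ A _ hxA).hom
      (congrArg CommRingCat.Hom.hom (aux_ffmap q h A hxA hgU))
  exact Module.finrank_pos (R := V.functionField) (M := U.functionField)

lemma aux_germ_resU (X : Scheme.{u}) {A B : X.Opens} (h : B ≤ A) (x : X) (hB : x ∈ B)
    (s : (Γ(X, A))ˣ) :
    X.presheaf.germ B x hB (resU X h s : (Γ(X, B))ˣ) = X.presheaf.germ A x (h hB) s :=
  TopCat.Presheaf.germ_res_apply X.presheaf (homOfLE h) x hB _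

lemma aux_pow_trivial {U V : Scheme.{u}} [IsIntegral U] [IsIntegral V]
    (hVnorm : ∀ x : V, IsIntegrallyClosed ↥(V.presheaf.stalk x)) (q : U ⟶ V)
    (hfin : IsFinite q)
    (h : q.base (genericPoint ↥U) = genericPoint ↥V) (L : LineBundleOn V ⊤)
    (hL : (LineBundleOn.pullback q L).IsTrivial) :
    (L.pow (funcFieldDegree q h)).IsTrivial := by
  obtain ⟨s, hs⟩ := hL
  choose t ht using fun i => ffNorm_unit hVnorm q hfin h (L.U i) (s i)
  refine ⟨t, fun i j => ?_⟩
  show (L.t i j) ^ _ = resU V (inf_le_left : L.U i ⊓ L.U j ≤ L.U i) (t i) *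
    (resU V (inf_le_right : L.U i ⊓ L.U j ≤ L.U j) (t j))⁻¹
  rw [eq_mul_inv_iff_mul_eq]
  by_cases hW : genericPoint V ∈ L.U i ⊓ L.U j
  swap
  · have hbot : L.U i ⊓ L.U j = ⊥ := by
      rw [eq_bot_iff]
      exact fun x hx => absurd (aux_gen_mem hx) hW
    have : Subsingleton Γ(V, L.U i ⊓ L.U j) := by
      rw [hbot]; infer_instance
    exact Units.ext (Subsingleton.elim _ _)
  have hU := aux_mem_preimage q h hW
  have hs' := hs i j
  rw [eq_mul_inv_iff_mul_eq] at hs'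
  have hs2 := congrArg (fun u : (Γ(U, q ⁻¹ᵁ L.U i ⊓ q ⁻¹ᵁ L.U j))ˣ =>
    U.presheaf.germ (q ⁻¹ᵁ L.U i ⊓ q ⁻¹ᵁ L.U j) (genericPoint U) ⟨hU.1, hU.2⟩ u.1) hs'
  have e1 : U.presheaf.germ (q ⁻¹ᵁ L.U i ⊓ q ⁻¹ᵁ L.U j) (genericPoint U) ⟨hU.1, hU.2⟩
      (LineBundleOn.mapU q (LineBundleOn.preimage_inf_le q (L.U i) (L.U j)) (L.t i j)).1 =
      (functionFieldMap q h).hom (V.presheaf.germ (L.U i ⊓ L.U j) _ hW (L.t i j).1) := by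
    have := congrArg (fun f => f.hom (L.t i j).1) (aux_ffmap q h (L.U i ⊓ L.U j) hW hU)
    refine Eq.trans ?_ this.symm
    show U.presheaf.germ (q ⁻¹ᵁ L.U i ⊓ q ⁻¹ᵁ L.U j) (genericPoint U) ⟨hU.1, hU.2⟩
      (q.appLE (L.U i ⊓ L.U j) _ (LineBundleOn.preimage_inf_le q (L.U i) (L.U j))
        (L.t i j).1) = _
    rw [Scheme.Hom.appLE]
    exact TopCat.Presheaf.germ_res_apply U.presheaf _ _ _ _
  have e2 := aux_germ_resU U (inf_le_left : q ⁻¹ᵁ L.U i ⊓ q ⁻¹ᵁ L.U j ≤ q ⁻¹ᵁ L.U i)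
    (genericPoint U) ⟨hU.1, hU.2⟩ (s i)
  have e3 := aux_germ_resU U (inf_le_right : q ⁻¹ᵁ L.U i ⊓ q ⁻¹ᵁ L.U j ≤ q ⁻¹ᵁ L.U j)
    (genericPoint U) ⟨hU.1, hU.2⟩ (s j)
  have hs3 : (functionFieldMap q h).hom (V.presheaf.germ (L.U i ⊓ L.U j) _ hW (L.t i j).1) *
      U.presheaf.germ (q ⁻¹ᵁ L.U j) _ hU.2 (s j).1 =
      U.presheaf.germ (q ⁻¹ᵁ L.U i) _ hU.1 (s i).1 := by
    rw [← e1, ← e2, ← e3, ← map_mul]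
    exact hs2
  have hs4 := congrArg (ffNorm q h) hs3
  rw [map_mul, ffNorm_map] at hs4
  apply Units.ext
  apply germ_injective_of_isIntegral V _ hW
  rw [Units.val_mul, map_mul, Units.val_pow_eq_pow_val, map_pow, aux_germ_resU, aux_germ_resU,
    ht i hW.1, ht j hW.2]
  exact hs4

end Helpers

open LineBundleOn in
/-- Let `q : U ⟶ V` be a finite surjective morphism of integral normal Noetherian
schemes, and `d` the degree of the induced extension of function fields. Then for every
line bundle `L` on `V` with `q^* L` trivial, `L^{⊗ d}` is trivial; in particular the
kernel of `q^* : Pic(V) → Pic(U)` is killed by `d` and hence consists of torsion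
elements. -/
theorem stmt_8 {U V : Scheme.{u}} [IsIntegral U] [IsIntegral V]
    [AlgebraicGeometry.IsNoetherian U] [AlgebraicGeometry.IsNoetherian V]
    (hUnorm : ∀ x : U, IsIntegrallyClosed ↥(U.presheaf.stalk x))
    (hVnorm : ∀ x : V, IsIntegrallyClosed ↥(V.presheaf.stalk x))
    (q : U ⟶ V) (hfin : IsFinite q) (hsurj : Function.Surjective q.base)
    (hgen : q.base (genericPoint ↥U) = genericPoint ↥V)
    (d : ℕ) (hd : d = funcFieldDegree q hgen) :
    (∀ L : LineBundleOn V ⊤,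
        (LineBundleOn.pullback q L).IsTrivial → (L.pow d).IsTrivial) ∧
      (∀ L : LineBundleOn V ⊤,
        (LineBundleOn.pullback q L).IsTrivial → L.IsTorsion) := by
  subst hd
  exact ⟨fun L hL => aux_pow_trivial hVnorm q hfin hgen L hL,
    fun L hL => ⟨_, funcFieldDegree_pos q hfin hgen,
      aux_pow_trivial hVnorm q hfin hgen L hL⟩⟩

end LocalPic
end
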